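/- arXiv:1504.08004 — 7 statements merged into one kernel-verified Lean document; each statement's English description precedes it below -/
import Mathlib

section
/- Let g ≥ 1 and let p be an element of the free *-algebra ℂ⟨X₁,…,X_g,X₁*,…,X_g*⟩. If for every n ≥ 1 the evaluation of p at every g-tuple of unitary n×n complex matrices is zero, then p belongs to the two-sided ideal generated by the 2g elements 1 − X_j*X_j and 1 − X_jX_j* (j = 1,…,g). Equivalently, a noncommutative trigonometric polynomial that vanishes under all finite-dimensional *-representations equals 0. -/
open Matrix

noncomputable section

/-- The free `*`-algebra `ℂ⟨X₁,…,X_g,X₁*,…,X_g*⟩`, modelled as the monoid algebra of the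
free monoid on `2g` letters: `Sum.inl j` is `X_j` and `Sum.inr j` is `X_j*`. -/
abbrev FA (g : ℕ) := MonoidAlgebra ℂ (FreeMonoid (Fin g ⊕ Fin g))

/-- The generator `X_j`. -/
def Xv (g : ℕ) (j : Fin g) : FA g := MonoidAlgebra.of ℂ _ (FreeMonoid.of (Sum.inl j))

/-- The generator `X_j*`. -/
def Xs (g : ℕ) (j : Fin g) : FA g := MonoidAlgebra.of ℂ _ (FreeMonoid.of (Sum.inr j))

/-- Evaluation at a `g`-tuple `A` of `n × n` complex matrices: `X_j ↦ A j`,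
`X_j* ↦ (A j)ᴴ`. -/
def evalAt {g n : ℕ} (A : Fin g → Matrix (Fin n) (Fin n) ℂ) :
    FA g →ₐ[ℂ] Matrix (Fin n) (Fin n) ℂ :=
  MonoidAlgebra.lift ℂ _ _ (FreeMonoid.lift (Sum.elim A (fun j => (A j)ᴴ)))

open Equiv

/-- Any finite subset of a free group is separated by the orbit map of a point under an action of
the free group on a finite set. -/
theorem FreeGroup.exists_perm_hom_injOn {α : Type*} (S : Set (FreeGroup α)) (hS : S.Finite) :
    ∃ (n : ℕ) (a : Fin n) (ρ : FreeGroup α →* Perm (Fin n)), S.InjOn fun h => ρ h a := by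
  classical
  let T : Set (FreeGroup α) :=
    insert 1 (⋃ h ∈ S, FreeGroup.mk '' {L | L ∈ h.toWord.tails})
  have hT : T.Finite :=
    (hS.biUnion fun h _ => (List.finite_toSet h.toWord.tails).image _).insert 1
  have : Finite T := hT
  have hone : (1 : FreeGroup α) ∈ T := Set.mem_insert _ _
  have hσ : ∀ x : α, ∃ σ : Perm T, ∀ (t : T) (h : FreeGroup.of x * t ∈ T), σ t = ⟨_, h⟩ := by
    intro x
    let e : {t : T // FreeGroup.of x * t ∈ T} ≃ {t : T // (FreeGroup.of x)⁻¹ * t ∈ T} :=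
      { toFun := fun t => ⟨⟨FreeGroup.of x * t, t.2⟩, by simp⟩
        invFun := fun t => ⟨⟨(FreeGroup.of x)⁻¹ * t, t.2⟩, by simp⟩
        left_inv := fun t => by simp
        right_inv := fun t => by simp }
    have : Fintype T := Fintype.ofFinite T
    exact ⟨e.extendSubtype, fun t h => e.extendSubtype_apply_of_mem t h⟩
  choose σ hσ using hσ
  have key : ∀ L : List (α × Bool), (∀ L' ∈ L.tails, FreeGroup.mk L' ∈ T) →
      (FreeGroup.lift σ (FreeGroup.mk L) ⟨1, hone⟩ : FreeGroup α) = FreeGroup.mk L := by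
    intro L
    induction L with
    | nil => intro _; simp [← FreeGroup.one_eq_mk]
    | cons y L ih =>
      intro hL
      obtain ⟨x, b⟩ := y
      have hmem : FreeGroup.mk L ∈ T := hL L (by simp)
      have hcons : FreeGroup.mk ((x, b) :: L) ∈ T := hL _ (by simp)
      have ih' : FreeGroup.lift σ (FreeGroup.mk L) ⟨1, hone⟩ = ⟨FreeGroup.mk L, hmem⟩ :=
        Subtype.ext (ih fun L' h => hL L' (by
          rw [List.mem_tails] at h ⊢
          exact h.trans (List.suffix_cons _ _)))
      have hsplit : FreeGroup.mk ((x, b) :: L) = FreeGroup.mk [(x, b)] * FreeGroup.mk L := by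
        simp [FreeGroup.mul_mk]
      rw [hsplit] at hcons ⊢
      rw [_root_.map_mul, Perm.mul_apply, ih']
      cases b with
      | true =>
        have hx : FreeGroup.mk [(x, true)] = FreeGroup.of x := rfl
        rw [hx] at hcons ⊢
        rw [FreeGroup.lift_apply_of, hσ x _ hcons]
      | false =>
        have hx : FreeGroup.mk [(x, false)] = (FreeGroup.of x)⁻¹ := by
          simp [FreeGroup.of, FreeGroup.inv_mk, FreeGroup.invRev]
        rw [hx] at hcons ⊢
        have hinv : σ x ⟨_, hcons⟩ = ⟨FreeGroup.mk L, hmem⟩ := by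
          rw [hσ x _ (by simpa using hmem)]
          simp
        rw [_root_.map_inv, FreeGroup.lift_apply_of, ← hinv]
        simp
  obtain ⟨n, ⟨e⟩⟩ := Finite.exists_equiv_fin T
  refine ⟨n, e ⟨1, hone⟩, e.permCongrHom.toMonoidHom.comp (FreeGroup.lift σ), ?_⟩
  have orbit : ∀ h ∈ S, (FreeGroup.lift σ h ⟨1, hone⟩ : FreeGroup α) = h := by
    intro h hh
    have := key h.toWord fun L hL =>
      Set.mem_insert_of_mem _ (Set.mem_biUnion hh (Set.mem_image_of_mem _ hL))
    rwa [FreeGroup.mk_toWord] at this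
  intro h hh k hk hhk
  have : FreeGroup.lift σ h ⟨1, hone⟩ = FreeGroup.lift σ k ⟨1, hone⟩ := by
    simpa using hhk
  rw [← orbit h hh, ← orbit k hk, this]

/-- The homomorphism from the free monoid on `X_j`, `X_j*` to the free group sending `X_j` to the
`j`-th generator and `X_j*` to its inverse. -/
def toFreeGroup (g : ℕ) : FreeMonoid (Fin g ⊕ Fin g) →* FreeGroup (Fin g) :=
  FreeMonoid.lift (Sum.elim FreeGroup.of fun j => (FreeGroup.of j)⁻¹)

/-- An element of the free `*`-algebra lies in the unitarity ideal as soon as its image in the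
group algebra of the free group vanishes. -/
theorem mem_span_of_mapDomain_eq_zero {g : ℕ} {p : FA g}
    (hp : MonoidAlgebra.mapDomainAlgHom ℂ ℂ (toFreeGroup g) p = 0) :
    p ∈ TwoSidedIdeal.span
      ((Set.range fun j => 1 - Xs g j * Xv g j) ∪
        (Set.range fun j => 1 - Xv g j * Xs g j)) := by
  set I := TwoSidedIdeal.span
      ((Set.range fun j => 1 - Xs g j * Xv g j) ∪
        (Set.range fun j => 1 - Xv g j * Xs g j))
  let π : FA g →ₐ[ℂ] I.ringCon.Quotient := I.ringCon.mkₐ (α := ℂ)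
  have hπ : ∀ x, π x = 0 ↔ x ∈ I := fun x => by
    rw [TwoSidedIdeal.mem_iff]
    exact I.ringCon.eq (a := x) (b := 0)
  let u : Fin g → I.ringCon.Quotientˣ := fun j =>
    { val := π (Xv g j)
      inv := π (Xs g j)
      val_inv := by
        have := (hπ _).2 (TwoSidedIdeal.subset_span (Or.inr ⟨j, rfl⟩))
        rw [_root_.map_sub, _root_.map_one, _root_.map_mul, sub_eq_zero] at this
        exact this.symm
      inv_val := by
        have := (hπ _).2 (TwoSidedIdeal.subset_span (Or.inl ⟨j, rfl⟩))
        rw [_root_.map_sub, _root_.map_one, _root_.map_mul, sub_eq_zero] at this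
        exact this.symm }
  have hfac : π = (MonoidAlgebra.lift ℂ _ _ ((Units.coeHom _).comp (FreeGroup.lift u))).comp
      (MonoidAlgebra.mapDomainAlgHom ℂ ℂ (toFreeGroup g)) := by
    apply MonoidAlgebra.algHom_ext'
    · apply FreeMonoid.hom_eq
      rintro (j | j)
      · simp [toFreeGroup, u, Xv]
      · simp [toFreeGroup, u, Xs]
    · exact Subsingleton.elim _ _
  rw [← hπ, hfac, AlgHom.comp_apply, hp, map_zero]

/-- Evaluation at permutation matrices factors through the group algebra of the free group. -/
theorem evalAt_permMatrixHom {g n : ℕ} (ρ : FreeGroup (Fin g) →* Perm (Fin n)) (p : FA g) :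
    evalAt (fun j => permMatrixHom (R := ℂ) (ρ (FreeGroup.of j))) p =
      MonoidAlgebra.lift ℂ _ _ (permMatrixHom.comp ρ)
        (MonoidAlgebra.mapDomainAlgHom ℂ ℂ (toFreeGroup g) p) := by
  rw [← AlgHom.comp_apply]
  congr 1
  apply MonoidAlgebra.algHom_ext'
  · apply FreeMonoid.hom_eq
    rintro (j | j)
    · simp [toFreeGroup, evalAt]
    · simp [toFreeGroup, evalAt]
  · exact Subsingleton.elim _ _

/-- The entry in row `ρ h a` and column `a` of the image of `P` under a permutation representation
is the coefficient of `h`, if `h` is determined by `ρ h a` within the support of `P`. -/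
theorem lift_permMatrixHom_apply {G : Type*} [Group G] {n : ℕ} (ρ : G →* Perm (Fin n)) (a : Fin n)
    (P : MonoidAlgebra ℂ G) (hinj : Set.InjOn (fun h => ρ h a) (P.coeff.support : Set G)) {h : G}
    (hh : h ∈ P.coeff.support) :
    MonoidAlgebra.lift ℂ (Matrix (Fin n) (Fin n) ℂ) _ (permMatrixHom.comp ρ) P (ρ h a) a =
      P.coeff h := by
  rw [MonoidAlgebra.lift_apply, Finsupp.sum, Matrix.sum_apply, Finset.sum_eq_single_of_mem h hh]
  · simp [Equiv.toPEquiv_apply]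
  · intro k hk hne
    have : ¬ (ρ k)⁻¹ (ρ h a) = a := fun H =>
      hne (hinj hk hh (Perm.inv_eq_iff_eq.1 H).symm)
    simpa [Equiv.toPEquiv_apply] using fun H => absurd H this

/-- **Nullstellensatz for nc trigonometric polynomials.**
If `p` vanishes at every `g`-tuple of unitary `n × n` complex matrices for every `n ≥ 1`,
then `p` lies in the two-sided ideal generated by the `2g` elements `1 - X_j* X_j` and
`1 - X_j X_j*`.  In particular, an nc trigonometric polynomial that vanishes under all
finite-dimensional `*`-representations is `0`. -/
theorem unitary_nullstellensatz (g : ℕ) (hg : 1 ≤ g) (p : FA g)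
    (hvan : ∀ (n : ℕ), 1 ≤ n → ∀ U : Fin g → Matrix (Fin n) (Fin n) ℂ,
      (∀ j, (U j)ᴴ * U j = 1 ∧ U j * (U j)ᴴ = 1) → evalAt U p = 0) :
    p ∈ TwoSidedIdeal.span
      ((Set.range fun j => 1 - Xs g j * Xv g j) ∪
        (Set.range fun j => 1 - Xv g j * Xs g j)) := by
  apply mem_span_of_mapDomain_eq_zero
  set P := MonoidAlgebra.mapDomainAlgHom ℂ ℂ (toFreeGroup g) p with hP
  obtain ⟨n, a, ρ, hρ⟩ :=
    FreeGroup.exists_perm_hom_injOn (P.coeff.support : Set (FreeGroup (Fin g)))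
      P.coeff.support.finite_toSet
  have hU := hvan n (Fin.pos a) (fun j => permMatrixHom (ρ (FreeGroup.of j))) fun j => by
    simp [← permMatrix_mul]
  rw [evalAt_permMatrixHom, ← hP] at hU
  ext h
  by_contra hne
  have hcoeff := lift_permMatrixHom_apply ρ a P hρ (Finsupp.mem_support_iff.2 hne)
  rw [hU] at hcoeff
  exact hne hcoeff.symm
end
end

section
/- Let g ≥ 2 and let p be an element of the free *-algebra ℂ⟨X₁,…,X_g,X₁*,…,X_g*⟩. If for every n ≥ 1 the evaluation of p at every g-tuple of n×n complex matrices that is a spherical isometry is zero, then p belongs to the two-sided ideal generated by 1 − X₁*X₁ − ⋯ − X_g*X_g. Equivalently, a noncommutative spherical polynomial (g > 1) that vanishes under all finite-dimensional *-representations equals 0. -/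
open Matrix

noncomputable section

/-- Evaluation of the free algebra at arbitrary values of the `2g` letters. -/
def letterEval {g : ℕ} {S : Type*} [Semiring S] [Algebra ℂ S] (F : Fin g ⊕ Fin g → S) :
    FA g →ₐ[ℂ] S :=
  MonoidAlgebra.lift ℂ _ _ (FreeMonoid.lift F)

section letterEval

variable {g : ℕ} {S T : Type*} [Semiring S] [Algebra ℂ S] [Semiring T] [Algebra ℂ T]

@[simp]
lemma letterEval_of_one (F : Fin g ⊕ Fin g → S) :
    letterEval F (MonoidAlgebra.of ℂ _ 1) = 1 := by
  simp [letterEval]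

lemma letterEval_of_mul (F : Fin g ⊕ Fin g → S) (a : Fin g ⊕ Fin g)
    (w : FreeMonoid (Fin g ⊕ Fin g)) :
    letterEval F (MonoidAlgebra.of ℂ _ (FreeMonoid.of a * w)) =
      F a * letterEval F (MonoidAlgebra.of ℂ _ w) := by
  simp [letterEval]

lemma map_letterEval (φ : S →ₐ[ℂ] T) (F : Fin g ⊕ Fin g → S) (p : FA g) :
    φ (letterEval F p) = letterEval (φ ∘ F) p := by
  induction p using MonoidAlgebra.induction_on with
  | of w =>
    induction w using FreeMonoid.inductionOn' with
    | one => simp only [map_one]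
    | of_mul a w ih => rw [letterEval_of_mul, map_mul, ih, letterEval_of_mul, Function.comp_apply]
  | add p q hp hq => simp only [map_add, hp, hq]
  | smul r p hp => simp only [map_smul, hp]

lemma mul_letterEval {U : S} {F G : Fin g ⊕ Fin g → S} (h : ∀ a, U * F a = G a * U) (p : FA g) :
    U * letterEval F p = letterEval G p * U := by
  induction p using MonoidAlgebra.induction_on with
  | of w =>
    induction w using FreeMonoid.inductionOn' with
    | one => simp only [letterEval_of_one, mul_one, one_mul]
    | of_mul a w ih => rw [letterEval_of_mul, letterEval_of_mul, ← mul_assoc, h, mul_assoc, ih,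
        mul_assoc]
  | add p q hp hq => rw [map_add, map_add, mul_add, add_mul, hp, hq]
  | smul r p hp => rw [map_smul, map_smul, mul_smul_comm, smul_mul_assoc, hp]

lemma letterEval_eq_sum (F : Fin g ⊕ Fin g → S) (p : FA g) :
    letterEval F p =
      ∑ w ∈ p.coeff.support, p.coeff w • letterEval F (MonoidAlgebra.of ℂ _ w) := by
  simp only [letterEval, MonoidAlgebra.lift_of]
  exact MonoidAlgebra.lift_apply _ _

lemma letterEval_generators (p : FA g) : letterEval (Sum.elim (Xv g) (Xs g)) p = p := by
  induction p using MonoidAlgebra.induction_on with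
  | of w =>
    induction w using FreeMonoid.inductionOn' with
    | one => simp only [map_one]
    | of_mul a w ih =>
      rw [letterEval_of_mul, ih, map_mul]
      cases a <;> rfl
  | add p q hp hq => rw [map_add, hp, hq]
  | smul r p hp => rw [map_smul, hp]

end letterEval

/-- The values of the letters at a tuple of matrices and its adjoints. -/
def starLetters {g : ℕ} {ι : Type*} (A : Fin g → Matrix ι ι ℂ) : Fin g ⊕ Fin g → Matrix ι ι ℂ :=
  Sum.elim A fun j => (A j)ᴴ

/-- A polynomial vanishing at all spherical isometries of every size `n ≥ 1`
vanishes at spherical isometries indexed by any finite type. -/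
lemma letterEval_starLetters_eq_zero {g : ℕ} {p : FA g}
    (hvan : ∀ (n : ℕ), 1 ≤ n → ∀ A : Fin g → Matrix (Fin n) (Fin n) ℂ,
      (∑ j, (A j)ᴴ * A j) = 1 → evalAt A p = 0)
    {ι : Type*} [Fintype ι] [DecidableEq ι] (A : Fin g → Matrix ι ι ℂ)
    (hA : ∑ j, (A j)ᴴ * A j = 1) : letterEval (starLetters A) p = 0 := by
  cases isEmpty_or_nonempty ι with
  | inl h => exact Subsingleton.elim _ _
  | inr h =>
    let e := reindexAlgEquiv ℂ ℂ (Fintype.equivFin ι)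
    have hstar (M : Matrix ι ι ℂ) : e Mᴴ = (e M)ᴴ :=
      (conjTranspose_reindex _ _ M).symm
    have h0 := hvan (Fintype.card ι) Fintype.card_pos (fun j => e (A j)) (by
      simp only [← hstar, ← map_mul, ← map_sum, hA, map_one])
    apply e.injective
    rw [map_zero, ← h0]
    refine (map_letterEval e.toAlgHom (starLetters A) p).trans ?_
    change letterEval _ p = letterEval _ p
    congr 2
    funext a
    cases a with
    | inl j => rfl
    | inr j => exact hstar (A j)

section dilation

variable {g : ℕ} {ι R R' : Type*} [Fintype ι] [DecidableEq ι] [CommRing R] [CommRing R']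

/-- A lift of arbitrary tuples `X`, `Y` of matrices to block triangular values of the letters
satisfying the spherical relation. -/
def dilation (i₀ i₁ : Fin g) (X Y : Fin g → Matrix ι ι R) :
    Fin g ⊕ Fin g → Matrix (ι ⊕ ι) (ι ⊕ ι) R :=
  Sum.elim
    (fun j => fromBlocks (X j) 0 (if j = i₀ then 1 - ∑ k, Y k * X k else 0)
      (if j = i₁ then 1 else 0))
    (fun j => fromBlocks (Y j) (if j = i₀ then 1 else 0) 0 (if j = i₁ then 1 else 0))

lemma dilation_map [Algebra ℂ R] [Algebra ℂ R'] (i₀ i₁ : Fin g) (X Y : Fin g → Matrix ι ι R)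
    (φ : R →ₐ[ℂ] R') :
    φ.mapMatrix ∘ dilation i₀ i₁ X Y =
      dilation i₀ i₁ (fun j => φ.mapMatrix (X j)) (fun j => φ.mapMatrix (Y j)) := by
  have hD : φ.mapMatrix (1 - ∑ k, Y k * X k) =
      1 - ∑ k, φ.mapMatrix (Y k) * φ.mapMatrix (X k) := by
    simp only [map_sub, map_one, map_sum, map_mul]
  funext a
  cases a with
  | inl j =>
    simp only [dilation, Function.comp_apply, Sum.elim_inl, ← hD]
    simp only [AlgHom.mapMatrix_apply, fromBlocks_map]
    split_ifs <;> simp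
  | inr j =>
    simp only [dilation, Function.comp_apply, Sum.elim_inr]
    simp only [AlgHom.mapMatrix_apply, fromBlocks_map]
    split_ifs <;> simp

/-- A tuple whose defect `1 - ∑ AᴴA` factors as `RᴴR` lifts to a spherical isometry
similar to its `dilation`. -/
lemma letterEval_dilation_of_defect {p : FA g}
    (hvan : ∀ (n : ℕ), 1 ≤ n → ∀ A : Fin g → Matrix (Fin n) (Fin n) ℂ,
      (∑ j, (A j)ᴴ * A j) = 1 → evalAt A p = 0)
    {i₀ i₁ : Fin g} (hi : i₀ ≠ i₁) (A : Fin g → Matrix ι ι ℂ) (R : Matrix ι ι ℂ)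
    (hR : 1 - ∑ j, (A j)ᴴ * A j = Rᴴ * R) (hunit : IsUnit Rᴴ) :
    letterEval (dilation i₀ i₁ A fun j => (A j)ᴴ) p = 0 := by
  let V : Fin g → Matrix (ι ⊕ ι) (ι ⊕ ι) ℂ := fun j =>
    fromBlocks (A j) 0 (if j = i₀ then R else 0) (if j = i₁ then 1 else 0)
  have hVs (j : Fin g) : (V j)ᴴ =
      fromBlocks (A j)ᴴ (if j = i₀ then Rᴴ else 0) 0 (if j = i₁ then 1 else 0) := by
    simp only [V, fromBlocks_conjTranspose]
    split_ifs <;> simp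
  have hVj (j : Fin g) : (V j)ᴴ * V j =
      fromBlocks ((A j)ᴴ * A j + if j = i₀ then Rᴴ * R else 0) 0 0 (if j = i₁ then 1 else 0) := by
    rw [hVs]
    simp only [V, fromBlocks_multiply]
    by_cases h₀ : j = i₀
    · have h₁ : j ≠ i₁ := h₀ ▸ hi
      simp [h₀, hi]
    · by_cases h₁ : j = i₁
      · simp [h₁, hi.symm]
      · simp [h₀, h₁]
  have hV : ∑ j, (V j)ᴴ * V j = 1 := by
    have hsum (B C : Fin g → Matrix ι ι ℂ) :
        ∑ j, fromBlocks (B j) 0 0 (C j) = fromBlocks (∑ j, B j) 0 0 (∑ j, C j) := by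
      ext (a | a) (b | b) <;> simp [Matrix.sum_apply]
    simp only [hVj, hsum, Finset.sum_add_distrib, Finset.sum_ite_eq', Finset.mem_univ, if_true,
      ← hR, add_sub_cancel, fromBlocks_one]
  have hzero := letterEval_starLetters_eq_zero hvan V hV
  obtain ⟨u, hu⟩ := hunit
  let U : Matrix (ι ⊕ ι) (ι ⊕ ι) ℂ := fromBlocks 1 0 0 Rᴴ
  let U' : Matrix (ι ⊕ ι) (ι ⊕ ι) ℂ := fromBlocks 1 0 0 (↑u⁻¹ : Matrix ι ι ℂ)
  have hUU' : U * U' = 1 := by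
    simp [U, U', fromBlocks_multiply, ← hu, fromBlocks_one]
  have hcomm := mul_letterEval (U := U) (F := starLetters V)
    (G := dilation i₀ i₁ A fun j => (A j)ᴴ) (by
      rintro (j | j)
      · simp only [starLetters, Sum.elim_inl, V, U, dilation, fromBlocks_multiply, hR]
        split_ifs <;> simp
      · simp only [starLetters, Sum.elim_inr, hVs, U, dilation, fromBlocks_multiply]
        split_ifs <;> simp) p
  rw [hzero, mul_zero] at hcomm
  rw [← mul_one (letterEval _ p), ← hUU', ← mul_assoc, ← hcomm, zero_mul]

open scoped Matrix.Norms.L2Operator MatrixOrder in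
/-- If `∑ AᴴA` has norm less than one, then its defect `1 - ∑ AᴴA` is `RᴴR` for some
invertible `R`. -/
lemma exists_defect_factor (A : Fin g → Matrix ι ι ℂ) (h : ‖∑ j, (A j)ᴴ * A j‖ < 1) :
    ∃ R : Matrix ι ι ℂ, 1 - ∑ j, (A j)ᴴ * A j = Rᴴ * R ∧ IsUnit Rᴴ := by
  have hpos : 0 ≤ ∑ j, (A j)ᴴ * A j := Finset.sum_nonneg fun j _ => star_mul_self_nonneg (A j)
  have hle := (CStarAlgebra.norm_le_one_iff_of_nonneg _ hpos).1 h.le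
  obtain ⟨R, hR⟩ := CStarAlgebra.nonneg_iff_eq_star_mul_self.1 (sub_nonneg.2 hle)
  refine ⟨R, hR, ?_⟩
  have hu := isUnit_one_sub_of_norm_lt_one h
  rw [hR, star_eq_conjTranspose, isUnit_iff_isUnit_det, det_mul] at hu
  exact (isUnit_iff_isUnit_det _).2 (isUnit_of_mul_isUnit_left hu)

open scoped Matrix.Norms.L2Operator in
lemma infinite_setOf_norm_sum_lt_one (A B : Fin g → Matrix ι ι ℂ) :
    {z : ℂ | star z = z ∧
      ‖∑ j, ((-z ^ 2) • A j + z • B j)ᴴ * ((-z ^ 2) • A j + z • B j)‖ < 1}.Infinite := by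
  let f : ℝ → ℝ := fun t => ‖∑ j, ((-(t : ℂ) ^ 2) • A j + (t : ℂ) • B j)ᴴ *
    ((-(t : ℂ) ^ 2) • A j + (t : ℂ) • B j)‖
  have hf : Continuous f := by fun_prop
  have hopen : IsOpen {t | f t < 1} := isOpen_lt hf continuous_const
  have h0 : (0 : ℝ) ∈ {t | f t < 1} := by simp [f]
  have hinf : {t | f t < 1}.Infinite := infinite_of_mem_nhds 0 (hopen.mem_nhds h0)
  refine (hinf.image Complex.ofReal_injective.injOn).mono ?_
  rintro _ ⟨t, ht, rfl⟩
  exact ⟨Complex.conj_ofReal t, ht⟩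

/-- A polynomial vanishing at spherical isometries vanishes at the dilation of any two tuples. -/
lemma letterEval_dilation {p : FA g}
    (hvan : ∀ (n : ℕ), 1 ≤ n → ∀ A : Fin g → Matrix (Fin n) (Fin n) ℂ,
      (∑ j, (A j)ᴴ * A j) = 1 → evalAt A p = 0)
    {i₀ i₁ : Fin g} (hi : i₀ ≠ i₁) (X Y : Fin g → Matrix ι ι ℂ) :
    letterEval (dilation i₀ i₁ X Y) p = 0 := by
  let A : Fin g → Matrix ι ι ℂ := fun j => (2⁻¹ : ℂ) • (X j + (Y j)ᴴ)
  let B : Fin g → Matrix ι ι ℂ := fun j => (-Complex.I * 2⁻¹) • (X j - (Y j)ᴴ)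
  let curve (M N : Matrix ι ι ℂ) : Matrix ι ι (Polynomial ℂ) :=
    (-Polynomial.X ^ 2 : Polynomial ℂ) • M.map Polynomial.C +
      (Polynomial.X : Polynomial ℂ) • N.map Polynomial.C
  have hcurve (z : ℂ) (M N : Matrix ι ι ℂ) :
      (Polynomial.aeval z).mapMatrix (curve M N) = (-z ^ 2) • M + z • N := by
    ext a b
    simp [curve, mul_comm z, mul_comm (z ^ 2)]
  let Q := letterEval (dilation i₀ i₁ (fun j => curve (A j) (B j))
    (fun j => curve (A j)ᴴ (B j)ᴴ)) p
  have hQ (z : ℂ) : (Polynomial.aeval z).mapMatrix Q =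
      letterEval (dilation i₀ i₁ (fun j => (-z ^ 2) • A j + z • B j)
        (fun j => (-z ^ 2) • (A j)ᴴ + z • (B j)ᴴ)) p := by
    rw [map_letterEval, dilation_map]
    simp only [hcurve]
  have hQ0 : Q = 0 := by
    ext1 a b
    refine Polynomial.eq_of_infinite_eval_eq _ _
      ((infinite_setOf_norm_sum_lt_one A B).mono ?_)
    rintro z ⟨hz, hnorm⟩
    obtain ⟨R, hR, hu⟩ := exists_defect_factor _ hnorm
    have h0 := letterEval_dilation_of_defect hvan hi _ R hR hu
    have hz' : star (-z ^ 2) = -z ^ 2 := by rw [star_neg, star_pow, hz]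
    simp only [conjTranspose_add, conjTranspose_smul, hz, hz'] at h0
    have := congrFun (congrFun ((hQ z).trans h0) a) b
    simpa [Polynomial.aeval_def, Polynomial.eval₂_eq_eval_map] using this
  have hX : (fun j => (-Complex.I ^ 2) • A j + Complex.I • B j) = X := by
    funext j
    ext a b
    simp only [A, B, Matrix.add_apply, Matrix.smul_apply, Matrix.sub_apply, smul_eq_mul]
    linear_combination (-X j a b) * Complex.I_sq
  have hY : (fun j => (-Complex.I ^ 2) • (A j)ᴴ + Complex.I • (B j)ᴴ) = Y := by
    funext j
    ext a b
    simp [A, B, Matrix.add_apply, Matrix.smul_apply, Matrix.sub_apply, smul_eq_mul]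
    ring_nf
    simp
    ring
  rw [← hX, ← hY, ← hQ, hQ0, map_zero]

end dilation

/-- A finite-dimensional subspace has coordinates defined on the whole space. -/
lemma exists_coordinates {Q : Type*} [AddCommGroup Q] [Module ℂ Q] (W : Submodule ℂ Q)
    [FiniteDimensional ℂ W] :
    ∃ (d : ℕ) (φ : Q →ₗ[ℂ] Fin d → ℂ) (ψ : (Fin d → ℂ) →ₗ[ℂ] Q), ∀ u ∈ W, ψ (φ u) = u := by
  obtain ⟨P, hP⟩ := LinearMap.exists_leftInverse_of_injective W.subtype W.ker_subtype
  let e := (Module.finBasis ℂ W).equivFun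
  refine ⟨_, e.toLinearMap ∘ₗ P, W.subtype ∘ₗ e.symm.toLinearMap, fun u hu => ?_⟩
  have := LinearMap.congr_fun hP ⟨u, hu⟩
  simp at this
  simp [this]

/-- A polynomial vanishing at all dilations vanishes at elements of any `ℂ`-algebra satisfying
the spherical relation. -/
lemma letterEval_eq_zero_of_dilation {g : ℕ} {Q : Type*} [Ring Q] [Algebra ℂ Q]
    (x y : Fin g → Q) (hxy : ∑ j, y j * x j = 1) (i₀ i₁ : Fin g) (p : FA g)
    (hp : ∀ (d : ℕ) (X Y : Fin g → Matrix (Fin d) (Fin d) ℂ),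
      letterEval (dilation i₀ i₁ X Y) p = 0) :
    letterEval (Sum.elim x y) p = 0 := by
  let word (w : FreeMonoid (Fin g ⊕ Fin g)) : Q :=
    letterEval (Sum.elim x y) (MonoidAlgebra.of ℂ _ w)
  have word_mul (a) (w) : word (FreeMonoid.of a * w) = Sum.elim x y a * word w :=
    letterEval_of_mul _ _ _
  let N := p.coeff.support.sup FreeMonoid.length
  let W := Submodule.span ℂ (word '' {w | w.length ≤ N + 2})
  have hfin : {w : FreeMonoid (Fin g ⊕ Fin g) | w.length ≤ N + 2}.Finite :=
    List.finite_length_le (Fin g ⊕ Fin g) (N + 2)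
  have : FiniteDimensional ℂ W := FiniteDimensional.span_of_finite ℂ (hfin.image word)
  have hW (w) (hw : w.length ≤ N + 2) : word w ∈ W :=
    Submodule.subset_span ⟨w, hw, rfl⟩
  obtain ⟨d, φ, ψ, hψ⟩ := exists_coordinates W
  let L (q : Q) : Matrix (Fin d) (Fin d) ℂ :=
    LinearMap.toMatrix' (φ ∘ₗ LinearMap.mulLeft ℂ q ∘ₗ ψ)
  have hL (q u : Q) (hu : u ∈ W) : L q *ᵥ φ u = φ (q * u) := by
    simp [L, LinearMap.toMatrix'_mulVec, hψ u hu]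
  let X := fun j => L (x j)
  let Y := fun j => L (y j)
  have hdefect (w : FreeMonoid (Fin g ⊕ Fin g)) (hw : w.length ≤ N) :
      (1 - ∑ k, Y k * X k) *ᵥ φ (word w) = 0 := by
    have hterm (k : Fin g) : (Y k * X k) *ᵥ φ (word w) = φ (y k * x k * word w) := by
      have h1 : x k * word w ∈ W := by
        have := hW (FreeMonoid.of (Sum.inl k) * w)
          (by rw [FreeMonoid.length_mul, FreeMonoid.length_of]; omega)
        rwa [word_mul] at this
      rw [← mulVec_mulVec, hL _ _ (hW w (by omega)), hL _ _ h1, mul_assoc]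
    rw [sub_mulVec, one_mulVec, sum_mulVec]
    simp only [hterm]
    rw [← map_sum, ← Finset.sum_mul, hxy, one_mul, sub_self]
  have hword (w : FreeMonoid (Fin g ⊕ Fin g)) (hw : w.length ≤ N + 1) :
      letterEval (dilation i₀ i₁ X Y) (MonoidAlgebra.of ℂ _ w) *ᵥ Sum.elim (φ (word 1)) 0 =
        Sum.elim (φ (word w)) 0 := by
    induction w using FreeMonoid.inductionOn' with
    | one => rw [letterEval_of_one, one_mulVec]
    | of_mul a w ih =>
      rw [FreeMonoid.length_mul, FreeMonoid.length_of] at hw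
      rw [letterEval_of_mul, ← mulVec_mulVec, ih (by omega), word_mul]
      cases a with
      | inl j =>
        simp only [dilation, Sum.elim_inl, fromBlocks_mulVec, Sum.elim_comp_inl,
          Sum.elim_comp_inr, mulVec_zero, add_zero]
        rw [← hL _ _ (hW w (by omega))]
        congr 1
        split_ifs
        · exact hdefect w (by omega)
        · exact zero_mulVec _
      | inr j =>
        simp only [dilation, Sum.elim_inr, fromBlocks_mulVec, Sum.elim_comp_inl,
          Sum.elim_comp_inr, mulVec_zero, add_zero, zero_mulVec]
        rw [← hL _ _ (hW w (by omega))]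
  have hlen (w) (hw : w ∈ p.coeff.support) : w.length ≤ N := Finset.le_sup hw
  have hpW : letterEval (Sum.elim x y) p = ∑ w ∈ p.coeff.support, p.coeff w • word w :=
    letterEval_eq_sum _ p
  have hmem : letterEval (Sum.elim x y) p ∈ W := by
    rw [hpW]
    exact W.sum_mem fun w hw => W.smul_mem _ (hW w (by have := hlen w hw; omega))
  have hφ : φ (letterEval (Sum.elim x y) p) = 0 := by
    have key : letterEval (dilation i₀ i₁ X Y) p *ᵥ Sum.elim (φ (word 1)) 0 =
        Sum.elim (φ (letterEval (Sum.elim x y) p)) 0 := by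
      rw [hpW, letterEval_eq_sum]
      simp only [map_sum, map_smul, sum_mulVec, smul_mulVec]
      rw [Finset.sum_congr rfl fun w hw => by rw [hword w (by have := hlen w hw; omega)]]
      ext (a | a) <;> simp
    rw [hp, zero_mulVec] at key
    exact (congrArg (· ∘ Sum.inl) key).symm
  rw [← hψ _ hmem, hφ, map_zero]

/-- **Nullstellensatz for nc spherical polynomials.**
Let `g ≥ 2`.  If `p` vanishes at every `g`-tuple of `n × n` complex matrices that is a
spherical isometry, for every `n ≥ 1`, then `p` lies in the two-sided ideal generated by
`1 - X₁* X₁ - ⋯ - X_g* X_g`.  In particular, an nc spherical polynomial (with `g > 1`)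
that vanishes under all finite-dimensional `*`-representations is `0`. -/
theorem spherical_nullstellensatz (g : ℕ) (hg : 2 ≤ g) (p : FA g)
    (hvan : ∀ (n : ℕ), 1 ≤ n → ∀ A : Fin g → Matrix (Fin n) (Fin n) ℂ,
      (∑ j, (A j)ᴴ * A j) = 1 → evalAt A p = 0) :
    p ∈ TwoSidedIdeal.span {1 - ∑ j, Xs g j * Xv g j} := by
  let I : TwoSidedIdeal (FA g) := TwoSidedIdeal.span {1 - ∑ j, Xs g j * Xv g j}
  let π : FA g →ₐ[ℂ] I.ringCon.Quotient := I.ringCon.mkₐ ℂ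
  have hπ (q : FA g) : π q = 0 ↔ q ∈ I := by
    rw [← sub_zero q, ← TwoSidedIdeal.rel_iff, sub_zero]
    exact RingCon.eq _
  have hrel : ∑ j, π (Xs g j) * π (Xv g j) = 1 := by
    have h := (hπ _).2 (TwoSidedIdeal.subset_span (Set.mem_singleton (1 - ∑ j, Xs g j * Xv g j)))
    rw [map_sub, map_one, sub_eq_zero] at h
    rw [h, map_sum]
    simp only [map_mul]
  have h0 := letterEval_eq_zero_of_dilation (fun j => π (Xv g j)) (fun j => π (Xs g j)) hrel
    ⟨0, by omega⟩ ⟨1, by omega⟩ p fun d X Y => letterEval_dilation hvan (by simp) X Y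
  have hcomp : Sum.elim (fun j => π (Xv g j)) (fun j => π (Xs g j)) =
      π ∘ Sum.elim (Xv g) (Xs g) := (Sum.comp_elim _ _ _).symm
  rw [hcomp, ← map_letterEval, letterEval_generators] at h0
  exact (hπ p).1 h0
end
end

section
/- Fix positive integers g and n. The set X(g,n) = {(A,B) : A, B are g-tuples of n×n complex matrices with Σ_{k=1}^g A_kB_k = I_n}, regarded as a subset of the space of pairs of g-tuples of n×n complex matrices with its standard (Euclidean) topology, is nonempty and connected. -/
open Matrix

noncomputable section

/-- The complement of the zero set of a nonzero complex polynomial is connected. -/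
theorem Polynomial.isPreconnected_eval_ne_zero {p : Polynomial ℂ} (hp : p ≠ 0) :
    IsPreconnected {z : ℂ | p.eval z ≠ 0} := by
  have hfin : {z : ℂ | p.eval z = 0}.Finite := by
    simpa [Polynomial.IsRoot] using Polynomial.finite_setOfPred_isRoot hp
  exact (hfin.countable.isConnected_compl_of_one_lt_rank
    (by rw [Complex.rank_real_complex]; norm_num)).isPreconnected

/-- Along the segments joining two pairs of tuples of complex matrices, the determinant of
`∑ k, A k * B k` is a polynomial in the complex parameter. -/
theorem Matrix.exists_polynomial_eval_eq_det_sum_lineMap_mul {ι m : Type*} [Fintype ι] [Fintype m]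
    [DecidableEq m] (A B A' B' : ι → Matrix m m ℂ) :
    ∃ p : Polynomial ℂ, ∀ z : ℂ, p.eval z =
      (∑ k, ((1 - z) • A k + z • A' k) * ((1 - z) • B k + z • B' k)).det := by
  let L (P Q : Matrix m m ℂ) : Matrix m m (Polynomial ℂ) :=
    (1 - Polynomial.X : Polynomial ℂ) • P.map Polynomial.C +
      (Polynomial.X : Polynomial ℂ) • Q.map Polynomial.C
  have hL (P Q : Matrix m m ℂ) (z : ℂ) :
      (Polynomial.evalRingHom z).mapMatrix (L P Q) = (1 - z) • P + z • Q := by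
    ext i j
    simp [L]
    ring
  refine ⟨(∑ k, L (A k) (A' k) * L (B k) (B' k)).det, fun z ↦ ?_⟩
  rw [← Polynomial.coe_evalRingHom, RingHom.map_det, map_sum]
  simp only [map_mul, hL]

/-- **Connectedness of `X(g,n)`:** the set of pairs `(A, B)` of `g`-tuples of `n × n`
complex matrices with `Σ_k A_k B_k = I_n`, with the standard Euclidean topology, is
nonempty and connected. -/
theorem X_isConnected (g n : ℕ) (hg : 0 < g) (hn : 0 < n) :
    IsConnected {AB : (Fin g → Matrix (Fin n) (Fin n) ℂ) × (Fin g → Matrix (Fin n) (Fin n) ℂ) |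
      (∑ k, AB.1 k * AB.2 k) = 1} := by
  refine ⟨⟨(Pi.single ⟨0, hg⟩ 1, fun _ ↦ 1), ?_⟩, isPreconnected_of_forall_pair ?_⟩
  · simp
  rintro ⟨A, B⟩ hAB ⟨A', B'⟩ hAB'
  simp only [Set.mem_ofPred_eq] at hAB hAB'
  obtain ⟨p, hp⟩ := Matrix.exists_polynomial_eval_eq_det_sum_lineMap_mul A B A' B'
  have hp0 : p.eval 0 = 1 := by simp [hp, hAB]
  have hp1 : p.eval 1 = 1 := by simp [hp, hAB']
  have hpne : p ≠ 0 := by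
    rintro rfl
    simp at hp0
  let a (z : ℂ) (k : Fin g) : Matrix (Fin n) (Fin n) ℂ := (1 - z) • A k + z • A' k
  let c (z : ℂ) (k : Fin g) : Matrix (Fin n) (Fin n) ℂ := (1 - z) • B k + z • B' k
  let M (z : ℂ) : Matrix (Fin n) (Fin n) ℂ := ∑ k, a z k * c z k
  have ha : Continuous a := by fun_prop
  have hc : Continuous c := by fun_prop
  have hM : Continuous M := by fun_prop
  -- Rescaling the right-hand tuple by `(M z)⁻¹` stays in the set wherever `M z` is invertible.
  let f (z : ℂ) : (Fin g → Matrix (Fin n) (Fin n) ℂ) × (Fin g → Matrix (Fin n) (Fin n) ℂ) :=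
    (a z, fun k ↦ c z k * ((p.eval z)⁻¹ • (M z).adjugate))
  have hf : ContinuousOn f {z | p.eval z ≠ 0} := by
    refine ha.continuousOn.prodMk (continuousOn_pi.2 fun k ↦ ?_)
    have hinv : ContinuousOn (fun z ↦ (p.eval z)⁻¹) {z | p.eval z ≠ 0} :=
      p.continuous.continuousOn.inv₀ fun _ hz ↦ hz
    exact ((continuous_apply k).comp hc).continuousOn.mul
      (hinv.smul hM.matrix_adjugate.continuousOn)
  refine ⟨f '' {z | p.eval z ≠ 0}, ?_, ⟨0, by simp [hp0], ?_⟩, ⟨1, by simp [hp1], ?_⟩,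
    (Polynomial.isPreconnected_eval_ne_zero hpne).image f hf⟩
  · rintro _ ⟨z, hz, rfl⟩
    have hdet : (M z).det = p.eval z := (hp z).symm
    simp only [Set.mem_ofPred_eq, f, ← Matrix.mul_assoc, ← Finset.sum_mul]
    change M z * _ = 1
    rw [Matrix.mul_smul, Matrix.mul_adjugate, hdet, smul_smul, inv_mul_cancel₀ hz, one_smul]
  · simp [f, a, c, M, hp0, hAB]
  · simp [f, a, c, M, hp1, hAB']
end
end

section
/- Let k be a field of characteristic zero, m ≥ 1, ℓ ≥ 1, and let A = M_m(k) be the algebra of m×m matrices over k. The k-linear map from the (ℓ+1)-fold tensor product A ⊗_k A ⊗_k ⋯ ⊗_k A to the space of ℓ-multilinear maps A^ℓ → A, determined on elementary tensors by sending a₀ ⊗ a₁ ⊗ ⋯ ⊗ a_ℓ to the multilinear map (b₁,…,b_ℓ) ↦ a₀b₁a₁b₂a₂⋯b_ℓa_ℓ, is injective. (Equivalently: a generalized multilinear polynomial over M_m(k) in ℓ distinct variables that vanishes under all matrix substitutions is zero.) -/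
open scoped TensorProduct PiTensorProduct

noncomputable section

/-- Interleaving matrices with the matrix units `single (c i) (r (i + 1)) 1` isolates a product of
individual entries. -/
theorem Matrix.mul_prod_ofFn_single_mul_apply {R n : Type*} [CommSemiring R] [Fintype n]
    [DecidableEq n] (l : ℕ) (a : Fin (l + 1) → Matrix n n R) (r c : Fin (l + 1) → n) :
    (a 0 * (List.ofFn fun i : Fin l =>
      Matrix.single (c i.castSucc) (r i.succ) (1 : R) * a i.succ).prod) (r 0) (c (Fin.last l)) =
      ∏ i, a i (r i) (c i) := by
  induction l with
  | zero => simp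
  | succ l ih =>
    have h := ih (fun i => a i.succ) (fun i => r i.succ) (fun i => c i.succ)
    simp only [Fin.succ_last, Fin.succ_castSucc] at h
    rw [Fin.prod_univ_succ, ← h, List.ofFn_succ, List.prod_cons, Matrix.mul_assoc, Matrix.mul_apply,
      Finset.sum_eq_single (c 0)]
    · simp
    · intro j _ hj
      simp [hj]
    · simp

/-- The entries of the standard-basis representation of a matrix are its entries. -/
theorem Matrix.stdBasis_repr_apply {R m n : Type*} [Semiring R] [Fintype m] [Finite n]
    (M : Matrix m n R) (p : m × n) : (Matrix.stdBasis R m n).repr M p = M p.1 p.2 := by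
  simp [Matrix.stdBasis]

/-- **Generalized multilinear polynomial identities over matrices are trivial.**
Let `k` be a field of characteristic zero, `A = M_m(k)`, and let
`Φ : A^{⊗(ℓ+1)} →ₗ[k] (multilinear maps A^ℓ → A)` be the `k`-linear map determined on
elementary tensors by sending `a₀ ⊗ a₁ ⊗ ⋯ ⊗ a_ℓ` to the interleaved-product map
`(b₁,…,b_ℓ) ↦ a₀ b₁ a₁ b₂ a₂ ⋯ b_ℓ a_ℓ`.  Then `Φ` is injective; equivalently, a
generalized multilinear polynomial over `M_m(k)` that vanishes under all matrix
substitutions is zero. -/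
theorem generalized_multilinear_injective (k : Type*) [Field k] [CharZero k]
    (m ℓ : ℕ) (hm : 1 ≤ m) (hℓ : 1 ≤ ℓ)
    (Φ : (⨂[k] (_ : Fin (ℓ + 1)), Matrix (Fin m) (Fin m) k) →ₗ[k]
      MultilinearMap k (fun _ : Fin ℓ => Matrix (Fin m) (Fin m) k)
        (Matrix (Fin m) (Fin m) k))
    (hΦ : ∀ (a : Fin (ℓ + 1) → Matrix (Fin m) (Fin m) k)
        (b : Fin ℓ → Matrix (Fin m) (Fin m) k),
      Φ (PiTensorProduct.tprod k a) b =
        a 0 * (List.ofFn fun i : Fin ℓ => b i * a i.succ).prod) :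
    Function.Injective Φ := by
  refine (injective_iff_map_eq_zero Φ).2 fun t ht => ?_
  let B := Basis.piTensorProduct fun _ : Fin (ℓ + 1) => Matrix.stdBasis k (Fin m) (Fin m)
  have key (p : Fin (ℓ + 1) → Fin m × Fin m) (t : ⨂[k] (_ : Fin (ℓ + 1)), Matrix (Fin m) (Fin m) k) :
      Φ t (fun i => Matrix.single (p i.castSucc).2 (p i.succ).1 1) (p 0).1 (p (Fin.last ℓ)).2 =
        B.repr t p := by
    induction t using PiTensorProduct.induction_on with
    | smul_tprod x a =>
      have h := Matrix.mul_prod_ofFn_single_mul_apply ℓ a (fun i => (p i).1) (fun i => (p i).2)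
      simp only [map_smul, smul_apply, Matrix.smul_apply, hΦ, h, B,
        Finsupp.smul_apply, Basis.piTensorProduct_repr_tprod_apply, Matrix.stdBasis_repr_apply]
    | add x y hx hy =>
      simp only [map_add, add_apply, Matrix.add_apply, hx, hy, Finsupp.add_apply]
  refine B.ext_elem fun p => ?_
  rw [← key, ht]
  simp
end
end

section
/- For all natural numbers m, n with m + n ≥ 1, there exist a positive integer N and matrices A, B ∈ M_N(ℂ) such that AB = 0, A^{n+1} = 0, B^{m+1} = 0, and B^mA^n ≠ 0. (For m, n ≥ 1 one may take N = m+n+1, A = Σ_{i=1}^n E_{i,i+1} and B = Σ_{i=n+2}^{n+m} E_{i,i+1} + E_{m+n+1,1}, where E_{ij} denote the standard matrix units.) -/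
open Matrix

noncomputable section

/-- The matrix of the partial shift sending the basis vector `e j` to `e (j + 1)` when
`a ≤ j < b`, and every other basis vector to `0`. -/
def partialShift (N a b : ℕ) : Matrix (Fin N) (Fin N) ℂ :=
  Matrix.of fun i j => if (i : ℕ) = j + 1 ∧ a ≤ (j : ℕ) ∧ (i : ℕ) ≤ b then 1 else 0

lemma partialShift_apply (N a b : ℕ) (i j : Fin N) :
    partialShift N a b i j =
      if (i : ℕ) = j + 1 ∧ a ≤ (j : ℕ) ∧ (i : ℕ) ≤ b then 1 else 0 := rfl

lemma partialShift_pow_apply (N a b k : ℕ) (i j : Fin N) :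
    (partialShift N a b ^ k) i j =
      if (i : ℕ) = j + k ∧ (k = 0 ∨ a ≤ (j : ℕ) ∧ (i : ℕ) ≤ b) then 1 else 0 := by
  induction k generalizing i j with
  | zero => simp [Matrix.one_apply, Fin.ext_iff]
  | succ k ih =>
    rw [pow_succ, Matrix.mul_apply]
    simp only [ih, partialShift_apply]
    by_cases h : (i : ℕ) = j + (k + 1) ∧ (k + 1 = 0 ∨ a ≤ (j : ℕ) ∧ (i : ℕ) ≤ b)
    · have hi := i.isLt
      rw [if_pos h, Finset.sum_eq_single ⟨(j : ℕ) + 1, by omega⟩]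
      · rw [if_pos ⟨by simp only; omega, by simp only; omega⟩,
          if_pos ⟨rfl, by omega, by simp only; omega⟩, mul_one]
      · intro l _ hl
        rw [if_neg fun hc : (l : ℕ) = j + 1 ∧ _ => hl (Fin.ext hc.1), mul_zero]
      · simp
    · rw [if_neg h]
      refine Finset.sum_eq_zero fun l _ => ?_
      simp only [← ite_and, mul_ite, mul_one, mul_zero]
      exact if_neg (by omega)

lemma partialShift_pow_eq_zero {N a b k : ℕ} (hk : b < a + k) (hk₀ : k ≠ 0) :
    partialShift N a b ^ k = 0 := by
  ext i j
  rw [partialShift_pow_apply, if_neg (by omega), Matrix.zero_apply]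

lemma partialShift_mul_partialShift_eq_zero (N a b c d : ℕ) (h : b ≤ c) :
    partialShift N a b * partialShift N c d = 0 := by
  ext i j
  rw [Matrix.mul_apply, Matrix.zero_apply]
  refine Finset.sum_eq_zero fun l _ => ?_
  simp only [partialShift_apply, ← ite_and, mul_ite, mul_one, mul_zero]
  exact if_neg (by omega)

lemma partialShift_pow_mul_pow_ne_zero (m n : ℕ) :
    partialShift (n + m + 1) n (n + m) ^ m * partialShift (n + m + 1) 0 n ^ n ≠ 0 := by
  intro h
  have h₁ := congrFun (congrFun h ⟨n + m, by omega⟩) ⟨0, by omega⟩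
  rw [Matrix.mul_apply, Finset.sum_eq_single ⟨n, by omega⟩] at h₁
  · simp [partialShift_pow_apply] at h₁
  · intro l _ hl
    have hl' : (l : ℕ) ≠ n := fun hc => hl (Fin.ext hc)
    rw [partialShift_pow_apply _ 0, if_neg (by simp only; omega), mul_zero]
  · simp

/-- For all `m, n` with `m + n ≥ 1` there exist square complex matrices `A, B` (of some
size `N ≥ 1`) with `AB = 0`, `A^{n+1} = 0`, `B^{m+1} = 0` and `B^m A^n ≠ 0`. -/
theorem exists_matrices_witness (m n : ℕ) (hmn : 1 ≤ m + n) :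
    ∃ (N : ℕ), 0 < N ∧ ∃ A B : Matrix (Fin N) (Fin N) ℂ,
      A * B = 0 ∧ A ^ (n + 1) = 0 ∧ B ^ (m + 1) = 0 ∧ B ^ m * A ^ n ≠ 0 := by
  refine ⟨n + m + 1, by omega, partialShift _ 0 n, partialShift _ n (n + m),
    partialShift_mul_partialShift_eq_zero _ _ _ _ _ le_rfl,
    partialShift_pow_eq_zero (by omega) (by omega),
    partialShift_pow_eq_zero (by omega) (by omega), partialShift_pow_mul_pow_ne_zero m n⟩
end
end

section
/- Let f be an element of the free associative ℂ-algebra ℂ⟨X,Y⟩ on two generators. If for every n ≥ 1 and all matrices A, B ∈ M_n(ℂ) with AB = 0 the evaluation of f at (A,B) (substituting X ↦ A, Y ↦ B) is zero, then f belongs to the two-sided ideal of ℂ⟨X,Y⟩ generated by the single element XY. (That is, the ideal (XY) has the Nullstellensatz property.) -/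
open Matrix

noncomputable section

lemma FreeAlgebra.basisFreeMonoid_apply_eq_prod {R X : Type*} [CommSemiring R] (v : FreeMonoid X) :
    FreeAlgebra.basisFreeMonoid R X v = (v.toList.map (FreeAlgebra.ι R)).prod := by
  simp [FreeAlgebra.basisFreeMonoid, FreeAlgebra.equivMonoidAlgebraFreeMonoid,
    FreeMonoid.lift_apply]

/-- The matrix on the suffixes of the word `w` (indexed by their starting positions) whose entry
at a pair of suffixes is `1` if the first one is the letter `x` followed by the second one. -/
def suffixMatrix (R : Type*) [Zero R] [One R] {X : Type*} [DecidableEq X] (w : List X) (x : X) :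
    Matrix (Fin (w.length + 1)) (Fin (w.length + 1)) R :=
  Matrix.of fun k l ↦ if w.drop k = x :: w.drop l then 1 else 0

lemma List.drop_fin_injective {X : Type*} (w : List X) :
    Function.Injective fun k : Fin (w.length + 1) ↦ w.drop k := by
  intro k l h
  have := congrArg List.length h
  simp only [List.length_drop] at this
  omega

lemma prod_map_suffixMatrix_apply (R : Type*) [Semiring R] {X : Type*} [DecidableEq X]
    (w v : List X) (k l : Fin (w.length + 1)) :
    (v.map (suffixMatrix R w)).prod k l = if w.drop k = v ++ w.drop l then 1 else 0 := by
  induction v generalizing k with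
  | nil => simp [Matrix.one_apply, w.drop_fin_injective.eq_iff.symm]
  | cons x v ih =>
    rw [List.map_cons, List.prod_cons, Matrix.mul_apply]
    simp only [ih, suffixMatrix, Matrix.of_apply, ite_zero_mul_ite_zero, mul_one]
    by_cases h : w.drop k = x :: v ++ w.drop l
    · have hk : (k : ℕ) < w.length := by
        by_contra! hk
        simp [List.drop_eq_nil_of_le hk] at h
      have hsucc : w.drop (k + 1) = v ++ w.drop l := by
        rw [← List.tail_drop, h]; rfl
      rw [if_pos h, Finset.sum_eq_single ⟨k + 1, by omega⟩]
      · simp [hsucc, h]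
      · rintro m - hm
        refine if_neg fun ⟨_, hm'⟩ ↦ hm (w.drop_fin_injective ?_)
        simp [hm', hsucc]
      · simp
    · rw [if_neg h]
      refine Finset.sum_eq_zero fun m _ ↦ if_neg fun ⟨h₁, h₂⟩ ↦ h ?_
      rw [h₁, h₂, List.cons_append]

/-- The corner entry of the evaluation at the suffix matrices of `w` is the coefficient of `w`. -/
lemma lift_suffixMatrix_apply_zero_last {R X : Type*} [CommSemiring R] [DecidableEq X]
    (w : FreeMonoid X) (f : FreeAlgebra R X) :
    FreeAlgebra.lift R (suffixMatrix R w.toList) f 0 (Fin.last _) =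
      (FreeAlgebra.basisFreeMonoid R X).repr f w := by
  suffices h : Matrix.entryLinearMap R R 0 (Fin.last _) ∘ₗ
      (FreeAlgebra.lift R (suffixMatrix R w.toList)).toLinearMap =
      (FreeAlgebra.basisFreeMonoid R X).coord w from LinearMap.congr_fun h f
  refine (FreeAlgebra.basisFreeMonoid R X).ext fun v ↦ ?_
  have h := prod_map_suffixMatrix_apply R w.toList v.toList 0 (Fin.last _)
  simp only [LinearMap.comp_apply, AlgHom.toLinearMap_apply, Matrix.entryLinearMap_apply,
    Module.Basis.coord_apply, Module.Basis.repr_self]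
  rw [FreeAlgebra.basisFreeMonoid_apply_eq_prod, map_list_prod, List.map_map]
  have hcomp : FreeAlgebra.lift R (suffixMatrix R w.toList) ∘ FreeAlgebra.ι R =
      suffixMatrix R w.toList := FreeAlgebra.ι_comp_lift _
  classical
  rw [hcomp, h, Fin.val_zero, List.drop_zero, Fin.val_last, List.drop_length, List.append_nil,
    Finsupp.single_apply]
  exact if_congr (FreeMonoid.toList.injective.eq_iff.trans eq_comm) rfl rfl

lemma suffixMatrix_mul_eq_zero (R : Type*) [Semiring R] {X : Type*} [DecidableEq X] {w : List X}
    {x y : X} (h : ¬ [x, y] <:+: w) : suffixMatrix R w x * suffixMatrix R w y = 0 := by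
  ext k l
  have hp := prod_map_suffixMatrix_apply R w [x, y] k l
  rw [if_neg fun hd ↦ h ⟨w.take k, w.drop l, by
    rw [List.append_assoc, ← hd, List.take_append_drop]⟩] at hp
  simpa using hp

/-- **The ideal `(XY)` has the Nullstellensatz property.**
If `f ∈ ℂ⟨X,Y⟩` vanishes at every pair `(A, B)` of square complex matrices (of any size
`n ≥ 1`) with `AB = 0`, then `f` lies in the two-sided ideal generated by `XY`. -/
theorem XY_nullstellensatz (f : FreeAlgebra ℂ (Fin 2))
    (hvan : ∀ (n : ℕ), 1 ≤ n → ∀ A B : Matrix (Fin n) (Fin n) ℂ, A * B = 0 →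
      FreeAlgebra.lift ℂ ![A, B] f = 0) :
    f ∈ TwoSidedIdeal.span {FreeAlgebra.ι ℂ (0 : Fin 2) * FreeAlgebra.ι ℂ (1 : Fin 2)} := by
  set I := TwoSidedIdeal.span {FreeAlgebra.ι ℂ (0 : Fin 2) * FreeAlgebra.ι ℂ (1 : Fin 2)}
  rw [← (FreeAlgebra.basisFreeMonoid ℂ (Fin 2)).linearCombination_repr f,
    Finsupp.linearCombination_apply]
  refine sum_mem fun w hw ↦ ?_
  have hinfix : [0, 1] <:+: w.toList := by
    by_contra h
    have hM := hvan _ (Nat.le_add_left 1 _) _ _ (suffixMatrix_mul_eq_zero ℂ h)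
    have heq : ![suffixMatrix ℂ w.toList 0, suffixMatrix ℂ w.toList 1] =
        suffixMatrix ℂ w.toList := by
      ext i : 1
      fin_cases i <;> rfl
    rw [heq] at hM
    refine Finsupp.mem_support_iff.mp hw ?_
    rw [← lift_suffixMatrix_apply_zero_last, hM, Matrix.zero_apply]
  obtain ⟨s, t, hst⟩ := hinfix
  beta_reduce
  rw [FreeAlgebra.basisFreeMonoid_apply_eq_prod, ← hst, Algebra.smul_def]
  simp only [List.map_append, List.prod_append, List.map_cons, List.map_nil, List.prod_cons,
    List.prod_nil, mul_one]
  exact I.mul_mem_left _ _ (I.mul_mem_right _ _ (I.mul_mem_left _ _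
    (TwoSidedIdeal.subset_span rfl)))
end
end

section
/- Let g ≥ 2. Let R be the quotient of the free ℂ-algebra on 2g² generators X_{ij}, Y_{ij} (1 ≤ i,j ≤ g) by the two-sided ideal generated by the 2g² relations Σ_{k=1}^g X_{ik}Y_{kj} − δ_{ij} and Σ_{k=1}^g Y_{ik}X_{kj} − δ_{ij} (i.e., XY = YX = I_g for the matrices X = (X_{ij}), Y = (Y_{ij})), and let S be the quotient of the free ℂ-algebra on 2g generators X₁,…,X_g, Y₁,…,Y_g by the two-sided ideal generated by X₁Y₁ + ⋯ + X_gY_g − 1. Then the ℂ-algebra homomorphism S → R induced by X_i ↦ X_{2i} and Y_i ↦ Y_{i2} is well defined and injective. -/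
noncomputable section

/-- The free `ℂ`-algebra on the `2g²` generators `X_{ij}` (= `Sum.inl (i,j)`) and
`Y_{ij}` (= `Sum.inr (i,j)`). -/
abbrev FR (g : ℕ) := FreeAlgebra ℂ ((Fin g × Fin g) ⊕ (Fin g × Fin g))

/-- The free `ℂ`-algebra on the `2g` generators `X_i` (= `Sum.inl i`) and
`Y_i` (= `Sum.inr i`). -/
abbrev FS (g : ℕ) := FreeAlgebra ℂ (Fin g ⊕ Fin g)

/-- The two-sided ideal of relations `XY = YX = I_g`, i.e. generated by the entries of
`XY - I_g` and `YX - I_g` for the `g × g` matrices `X = (X_{ij})`, `Y = (Y_{ij})`. -/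
def relR (g : ℕ) : TwoSidedIdeal (FR g) :=
  TwoSidedIdeal.span
    ({x | ∃ i j : Fin g, x =
        (∑ k, FreeAlgebra.ι ℂ (Sum.inl (i, k)) * FreeAlgebra.ι ℂ (Sum.inr (k, j))) -
          (if i = j then 1 else 0)} ∪
      {x | ∃ i j : Fin g, x =
        (∑ k, FreeAlgebra.ι ℂ (Sum.inr (i, k)) * FreeAlgebra.ι ℂ (Sum.inl (k, j))) -
          (if i = j then 1 else 0)})

/-- The two-sided ideal generated by `X₁Y₁ + ⋯ + X_gY_g - 1`. -/
def relS (g : ℕ) : TwoSidedIdeal (FS g) :=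
  TwoSidedIdeal.span
    {(∑ i, FreeAlgebra.ι ℂ (Sum.inl i) * FreeAlgebra.ι ℂ (Sum.inr i)) - 1}

/-- The `ℂ`-algebra homomorphism between the free algebras given on generators by
`X_i ↦ X_{2i}` and `Y_i ↦ Y_{i2}` (indices `2` written as `⟨1, _⟩ : Fin g`,
zero-based). -/
def emb (g : ℕ) (hg : 2 ≤ g) : FS g →ₐ[ℂ] FR g :=
  FreeAlgebra.lift ℂ
    (Sum.elim (fun i => FreeAlgebra.ι ℂ (Sum.inl ((⟨1, by omega⟩ : Fin g), i)))
      (fun i => FreeAlgebra.ι ℂ (Sum.inr (i, (⟨1, by omega⟩ : Fin g)))))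

/-- Two split epimorphisms `p, q : M → V`, with sections `s, t` and isomorphic kernels, differ by
an automorphism of `M` compatible with the sections. -/
theorem exists_linearEquiv_comp_eq_of_ker_equiv {K M V : Type*} [Ring K]
    [AddCommGroup M] [Module K M] [AddCommGroup V] [Module K V]
    (p q : M →ₗ[K] V) (s t : V →ₗ[K] M)
    (hp : ∀ v, p (s v) = v) (hq : ∀ v, q (t v) = v)
    (φ : LinearMap.ker p ≃ₗ[K] LinearMap.ker q) :
    ∃ T : M ≃ₗ[K] M, (∀ m, q (T m) = p m) ∧ ∀ v, T.symm (t v) = s v := by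
  have map_ker (m : LinearMap.ker p) : p m = 0 := m.2
  have map_ker' (m : LinearMap.ker q) : q m = 0 := m.2
  let P : M →ₗ[K] LinearMap.ker p := (LinearMap.id - s ∘ₗ p).codRestrict _ (by simp [hp])
  let Q : M →ₗ[K] LinearMap.ker q := (LinearMap.id - t ∘ₗ q).codRestrict _ (by simp [hq])
  have P_ker (m : LinearMap.ker p) : P m = m := Subtype.ext (by simp [P, map_ker])
  have Q_ker (m : LinearMap.ker q) : Q m = m := Subtype.ext (by simp [Q, map_ker'])
  have P_section (v : V) : P (s v) = 0 := Subtype.ext (by simp [P, hp])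
  have Q_section (v : V) : Q (t v) = 0 := Subtype.ext (by simp [Q, hq])
  have P_add (m : M) : (P m : M) + s (p m) = m := by simp [P]
  have Q_add (m : M) : (Q m : M) + t (q m) = m := by simp [Q]
  let F : M →ₗ[K] M := (LinearMap.ker q).subtype ∘ₗ φ.toLinearMap ∘ₗ P + t ∘ₗ p
  let G : M →ₗ[K] M := (LinearMap.ker p).subtype ∘ₗ φ.symm.toLinearMap ∘ₗ Q + s ∘ₗ q
  refine ⟨LinearEquiv.ofLinearMap F G ?_ ?_, fun m => ?_, fun v => ?_⟩
  · ext m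
    simp [F, G, P_ker, P_section, map_ker, hp, Q_add]
  · ext m
    simp [F, G, Q_ker, Q_section, map_ker', hq, P_add]
  · simp [F, map_ker', hq]
  · simp [G, Q_section, hq]

/-- The entries of an automorphism of `V^g` and of its inverse, as a representation of the free
algebra, annihilate the relations `XY = YX = 1`. -/
theorem lift_eq_zero_of_mem_relR {g : ℕ} {V : Type*} [AddCommGroup V] [Module ℂ V]
    (T : (Fin g → V) ≃ₗ[ℂ] (Fin g → V)) {a : FR g} (ha : a ∈ relR g) :
    FreeAlgebra.lift ℂ (A := Module.End ℂ V) (Sum.elim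
      (fun ij => LinearMap.proj ij.1 ∘ₗ T.toLinearMap ∘ₗ LinearMap.single ℂ (fun _ => V) ij.2)
      (fun ij => LinearMap.proj ij.1 ∘ₗ T.symm.toLinearMap ∘ₗ
        LinearMap.single ℂ (fun _ => V) ij.2)) a = 0 := by
  have entries (A B : (Fin g → V) →ₗ[ℂ] (Fin g → V)) (hAB : ∀ u, A (B u) = u) (i j : Fin g)
      (v : V) :
      ∑ k, A (Pi.single k (B (Pi.single j v) k)) i = if i = j then v else 0 := by
    rw [← Finset.sum_apply, ← map_sum, Finset.univ_sum_single, hAB, Pi.single_apply]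
  rw [← TwoSidedIdeal.mem_ker]
  refine (TwoSidedIdeal.span_le.2 ?_) ha
  rintro x (⟨i, j, rfl⟩ | ⟨i, j, rfl⟩)
  · rw [SetLike.mem_coe, TwoSidedIdeal.mem_ker]
    have := entries T.toLinearMap T.symm.toLinearMap (by simp) i j
    ext v
    split_ifs with h <;> simp_all
  · rw [SetLike.mem_coe, TwoSidedIdeal.mem_ker]
    have := entries T.symm.toLinearMap T.toLinearMap (by simp) i j
    ext v
    split_ifs with h <;> simp_all

theorem emb_mem_relR {g : ℕ} (hg : 2 ≤ g) {a : FS g} (ha : a ∈ relS g) :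
    emb g hg a ∈ relR g := by
  rw [← TwoSidedIdeal.mem_comap (emb g hg)]
  refine (TwoSidedIdeal.span_le.2 ?_) ha
  rintro x rfl
  rw [SetLike.mem_coe, TwoSidedIdeal.mem_comap]
  refine TwoSidedIdeal.subset_span (Or.inl ⟨⟨1, by omega⟩, ⟨1, by omega⟩, ?_⟩)
  simp [emb]

/-- The quotient algebra `S`. -/
abbrev QuotS (g : ℕ) := (relS g).ringCon.Quotient

/-- The quotient map onto `S`. -/
def mkS (g : ℕ) : FS g →ₐ[ℂ] QuotS g := (relS g).ringCon.mkₐ ℂ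

theorem mkS_eq_zero_iff {g : ℕ} {a : FS g} : mkS g a = 0 ↔ a ∈ relS g := by
  rw [TwoSidedIdeal.mem_iff]
  exact RingCon.eq _

/-- The character sending `X_i` and `Y_i` to `1` for `i = i₀` and to `0` otherwise. -/
def coordChar {g : ℕ} (i₀ : Fin g) : FS g →ₐ[ℂ] ℂ :=
  FreeAlgebra.lift ℂ (Sum.elim (Pi.single i₀ 1) (Pi.single i₀ 1))

/-- A faithful `S`-module: the regular one plus infinitely many copies of a character. -/
abbrev ModS (g : ℕ) := QuotS g × (ℕ →₀ ℂ)

/-- The action of the free algebra on `ModS g`. -/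
def repS {g : ℕ} (i₀ : Fin g) : FS g →ₐ[ℂ] Module.End ℂ (ModS g) :=
  (LinearMap.prodMapAlgHom ℂ (QuotS g) (ℕ →₀ ℂ)).comp
    (((Algebra.lmul ℂ (QuotS g)).comp (mkS g)).prod
      ((Algebra.lsmul ℂ ℂ (ℕ →₀ ℂ)).comp (coordChar i₀)))

theorem repS_apply {g : ℕ} (i₀ : Fin g) (a : FS g) (v : ModS g) :
    repS i₀ a v = (mkS g a * v.1, coordChar i₀ a • v.2) := rfl

theorem sum_repS_repS {g : ℕ} (i₀ : Fin g) (v : ModS g) :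
    ∑ i, repS i₀ (FreeAlgebra.ι ℂ (Sum.inl i)) (repS i₀ (FreeAlgebra.ι ℂ (Sum.inr i)) v) = v := by
  have hS : ∑ i,
      mkS g (FreeAlgebra.ι ℂ (Sum.inl i)) * mkS g (FreeAlgebra.ι ℂ (Sum.inr i)) = 1 := by
    rw [← sub_eq_zero]
    simpa using mkS_eq_zero_iff.2 (TwoSidedIdeal.subset_span (Set.mem_singleton
      (∑ i : Fin g, FreeAlgebra.ι ℂ (Sum.inl i) * FreeAlgebra.ι ℂ (Sum.inr i) - 1)))
  ext1
  · simp [repS_apply, Prod.fst_sum, ← mul_assoc, ← Finset.sum_mul, hS]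
  · simp [repS_apply, Prod.snd_sum, coordChar, Pi.single_apply]

theorem rank_modS_le (g : ℕ) : Module.rank ℂ (ModS g) ≤ Cardinal.aleph0 := by
  have hmk : Function.Surjective (mkS g).toLinearMap := Quotient.mk_surjective
  have : Module.rank ℂ (QuotS g) ≤ Cardinal.aleph0 := by
    refine (LinearMap.rank_le_of_surjective _ hmk).trans ?_
    rw [FreeAlgebra.rank_eq, Cardinal.lift_le_aleph0]
    exact Cardinal.mk_le_aleph0
  rw [rank_prod']
  exact Cardinal.add_le_aleph0.2 ⟨this, by simp⟩

theorem rank_eq_aleph0_of_single_mem {g : ℕ} (N : Submodule ℂ (Fin g → ModS g)) (i : Fin g)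
    (hN : ∀ w, Pi.single i (0, w) ∈ N) : Module.rank ℂ N = Cardinal.aleph0 := by
  refine le_antisymm ((Submodule.rank_le N).trans ?_) ?_
  · rw [rank_fun]
    exact (mul_le_mul' Cardinal.natCast_le_aleph0 (rank_modS_le g)).trans_eq
      Cardinal.aleph0_mul_aleph0
  · let f : (ℕ →₀ ℂ) →ₗ[ℂ] N :=
      (LinearMap.single ℂ (fun _ => ModS g) i ∘ₗ LinearMap.inr ℂ _ _).codRestrict N hN
    have f_apply (v : ℕ →₀ ℂ) : (f v : Fin g → ModS g) i = (0, v) := Pi.single_eq_same i _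
    have hf : Function.Injective f := fun v w h =>
      congrArg Prod.snd ((f_apply v).symm.trans (h ▸ f_apply w))
    simpa using LinearMap.rank_le_of_injective f hf

theorem mem_relS_of_emb_mem_relR {g : ℕ} (hg : 2 ≤ g) {a : FS g} (ha : emb g hg a ∈ relR g) :
    a ∈ relS g := by
  let i₀ : Fin g := ⟨0, by omega⟩
  let i₁ : Fin g := ⟨1, by omega⟩
  have hne : i₁ ≠ i₀ := by simp [i₀, i₁]
  let p : (Fin g → ModS g) →ₗ[ℂ] ModS g :=
    LinearMap.lsum ℂ _ ℂ fun i => repS i₀ (FreeAlgebra.ι ℂ (Sum.inl i))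
  let s : ModS g →ₗ[ℂ] (Fin g → ModS g) :=
    LinearMap.pi fun i => repS i₀ (FreeAlgebra.ι ℂ (Sum.inr i))
  let q : (Fin g → ModS g) →ₗ[ℂ] ModS g := LinearMap.proj i₁
  have hp_single (i : Fin g) (v : ModS g) :
      p (Pi.single i v) = repS i₀ (FreeAlgebra.ι ℂ (Sum.inl i)) v :=
    LinearMap.lsum_piSingle ..
  have hp : Module.rank ℂ (LinearMap.ker p) = Cardinal.aleph0 :=
    rank_eq_aleph0_of_single_mem _ i₁ fun w => by
      simp [hp_single, repS_apply, coordChar, hne]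
  have hq : Module.rank ℂ (LinearMap.ker q) = Cardinal.aleph0 :=
    rank_eq_aleph0_of_single_mem _ i₀ fun w => by simp [q, hne]
  have := Module.Free.of_divisionRing ℂ (LinearMap.ker p)
  have := Module.Free.of_divisionRing ℂ (LinearMap.ker q)
  obtain ⟨φ⟩ := nonempty_linearEquiv_of_rank_eq (hp.trans hq.symm)
  obtain ⟨T, hT, hT'⟩ := exists_linearEquiv_comp_eq_of_ker_equiv p q s
    (LinearMap.single ℂ (fun _ => ModS g) i₁)
    (fun v => by simp [p, s, sum_repS_repS]) (fun v => by simp [q]) φ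
  have hρ := lift_eq_zero_of_mem_relR T ha
  rw [← AlgHom.comp_apply] at hρ
  have hcomp : (FreeAlgebra.lift ℂ (A := Module.End ℂ (ModS g)) (Sum.elim
      (fun ij => LinearMap.proj ij.1 ∘ₗ T.toLinearMap ∘ₗ
        LinearMap.single ℂ (fun _ => ModS g) ij.2)
      (fun ij => LinearMap.proj ij.1 ∘ₗ T.symm.toLinearMap ∘ₗ
        LinearMap.single ℂ (fun _ => ModS g) ij.2))).comp (emb g hg) = repS i₀ := by
    refine FreeAlgebra.hom_ext (funext fun k => LinearMap.ext fun v => ?_)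
    rcases k with i | i
    · simp only [emb, AlgHom.comp_apply, Function.comp_apply, FreeAlgebra.lift_ι_apply,
        Sum.elim_inl]
      exact (hT (Pi.single i v)).trans (hp_single i v)
    · simp only [emb, AlgHom.comp_apply, Function.comp_apply, FreeAlgebra.lift_ι_apply,
        Sum.elim_inr]
      exact congrFun (hT' v) i
  rw [hcomp] at hρ
  have := congrArg Prod.fst (LinearMap.congr_fun hρ (1, 0))
  simpa [repS_apply, mkS_eq_zero_iff] using this

/-- **Embedding of `ℂ⟨x,y⟩/(Σᵢ xᵢyᵢ - 1)` into the universal `g × g` matrix-inverse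
algebra.**  For `g ≥ 2`, the map `X_i ↦ X_{2i}`, `Y_i ↦ Y_{i2}` sends the relation ideal
of `S` into the relation ideal of `R` (so it induces a well-defined `ℂ`-algebra
homomorphism `S → R` on the quotients), and the induced homomorphism is injective (the
preimage of the relation ideal of `R` is exactly the relation ideal of `S`). -/
theorem emb_wellDefined_and_injective (g : ℕ) (hg : 2 ≤ g) :
    (∀ a ∈ relS g, emb g hg a ∈ relR g) ∧
      (∀ a : FS g, emb g hg a ∈ relR g → a ∈ relS g) := by
  exact ⟨fun _ => emb_mem_relR hg, fun _ => mem_relS_of_emb_mem_relR hg⟩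
end
end
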